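/- arXiv:2101.07087 — 5 statements merged into one kernel-verified Lean document; each statement's English description precedes it below -/
import Mathlib

section
/- Let N₀, N₁ be positive integers, γ the standard Gaussian product measure on ℝ^(N₀N₁), and Y_i(x) = N₁^(-1/2) · Σ_{k=(i-1)N₁+1}^{iN₁} x_k for i ∈ {1,…,N₀}. For multi-indices a ∈ ℤ₊^{N₀} and a' ∈ ℤ₊^{N₀N₁}, the integral ∫ (Π_{i=1}^{N₀} Ĥ_{a_i}(Y_i(x))) · (Π_{j=1}^{N₀N₁} Ĥ_{a'_j}(x_j)) dγ(x) equals √(a!/a'!) · N₁^{-|a|/2} if a' matches a, and equals 0 otherwise. -/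
open MeasureTheory ProbabilityTheory Finset
open scoped Classical

/-- The normalized (probabilists') Hermite polynomial `Ĥ_m = He_m / √(m!)`. -/
noncomputable def normalizedHermite (m : ℕ) (x : ℝ) : ℝ :=
  (Polynomial.aeval x (Polynomial.hermite m)) / Real.sqrt (Nat.factorial m)

/-- `a' ∈ ℤ₊^{N₀N₁}` matches `a ∈ ℤ₊^{N₀}` if `Σ_{k=1}^{i} a_k = Σ_{k=1}^{iN₁} a'_k`
for every `i ∈ {1,…,N₀}` (written 0-indexed). -/
def MultiIndexMatches (N₀ N₁ : ℕ) (a : Fin N₀ → ℕ) (a' : Fin (N₀ * N₁) → ℕ) : Prop :=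
  ∀ i : Fin N₀,
    ∑ k ∈ Finset.univ.filter (fun k : Fin (N₀ * N₁) => (k : ℕ) < ((i : ℕ) + 1) * N₁), a' k
      = ∑ k ∈ Finset.univ.filter (fun k : Fin N₀ => k ≤ i), a k

/-- The block averages `Y_i(x) = N₁^{-1/2} Σ_{k=(i-1)N₁+1}^{iN₁} x_k` (written 0-indexed). -/
noncomputable def blockAverage (N₀ N₁ : ℕ) (i : Fin N₀) (x : Fin (N₀ * N₁) → ℝ) : ℝ :=
  (1 / Real.sqrt N₁) *
    ∑ k ∈ Finset.univ.filter
      (fun k : Fin (N₀ * N₁) => (i : ℕ) * N₁ ≤ (k : ℕ) ∧ (k : ℕ) < ((i : ℕ) + 1) * N₁), x k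

open Polynomial in
theorem derivative_hermite_succ (n : ℕ) :
    derivative (hermite (n + 1)) = ((n : ℤ[X]) + 1) * hermite n := by
  induction n with
  | zero => simp
  | succ n ih =>
    rw [hermite_succ (n + 1), derivative_sub, derivative_mul, ih]
    have h : derivative (((n : ℤ[X]) + 1) * hermite n)
        = ((n : ℤ[X]) + 1) * derivative (hermite n) := by
      simp [derivative_mul]
    rw [h]
    push_cast
    have h2 := hermite_succ n
    simp only [derivative_X]
    linear_combination (-(n : ℤ[X]) - 1) * h2

open Polynomial in
theorem integrable_eval_gaussianReal (p : ℝ[X]) :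
    Integrable (fun x => p.eval x) (gaussianReal 0 1) := by
  simp_rw [eval_eq_sum_range]
  refine integrable_finsetSum _ fun i _ => Integrable.const_mul ?_ _
  have h := (memLp_id_gaussianReal (μ := 0) (v := 1) (i : NNReal)).integrable_norm_pow'
  refine (integrable_norm_iff (by fun_prop)).1 ?_
  simpa using h

open Polynomial in
/-- The Stein identity for polynomials. -/
theorem integral_X_mul_gaussianReal (p : ℝ[X]) :
    ∫ x, (X * p).eval x ∂(gaussianReal 0 1) = ∫ x, (derivative p).eval x ∂(gaussianReal 0 1) := by
  have hint (q : ℝ[X]) : Integrable (fun x => gaussianPDFReal 0 1 x * q.eval x) := by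
    have h := integrable_eval_gaussianReal q
    rw [gaussianReal_of_var_ne_zero _ one_ne_zero,
      integrable_withDensity_iff_integrable_smul' (measurable_gaussianPDF _ _)
        (ae_of_all _ fun _ => gaussianPDF_lt_top)] at h
    simpa using h
  have hd (x : ℝ) : HasDerivAt (fun x => gaussianPDFReal 0 1 x * p.eval x)
      (gaussianPDFReal 0 1 x * (derivative p - X * p).eval x) x := by
    have h1 : HasDerivAt (fun x => gaussianPDFReal 0 1 x) (gaussianPDFReal 0 1 x * (-x)) x := by
      simp only [gaussianPDFReal_def]
      have h2 : HasDerivAt (fun x : ℝ => -(x - 0) ^ 2 / (2 * ((1 : NNReal) : ℝ))) (-x) x := by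
        have := ((((hasDerivAt_id x).sub_const 0).pow 2).neg).div_const (2 * ((1 : NNReal) : ℝ))
        convert! this using 1
        simp
        ring
      convert! (h2.exp.const_mul _) using 1
      ring
    convert! h1.mul (p.hasDerivAt x) using 1
    simp
    ring
  have h0 := integral_eq_zero_of_hasDerivAt_of_integrable hd (hint _) (hint _)
  have h1 : ∫ x, (derivative p - X * p).eval x ∂(gaussianReal 0 1) = 0 := by
    rw [integral_gaussianReal_eq_integral_smul one_ne_zero]
    simpa using h0
  simp only [eval_sub] at h1
  rw [integral_sub (integrable_eval_gaussianReal _) (integrable_eval_gaussianReal _)] at h1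
  linarith

open Polynomial in
theorem integral_hermite_succ_mul_gaussianReal (n : ℕ) (q : ℝ[X]) :
    ∫ x, ((hermite (n + 1)).map (Int.castRingHom ℝ) * q).eval x ∂(gaussianReal 0 1)
      = ∫ x, ((hermite n).map (Int.castRingHom ℝ) * derivative q).eval x ∂(gaussianReal 0 1) := by
  set h := (hermite n).map (Int.castRingHom ℝ) with hh
  have e1 : (hermite (n + 1)).map (Int.castRingHom ℝ) * q = X * (h * q) - derivative h * q := by
    rw [hermite_succ, hh]
    simp [derivative_map]
    ring
  have e2 : h * derivative q = derivative (h * q) - derivative h * q := by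
    rw [derivative_mul]; ring
  rw [e1, e2]
  simp only [eval_sub]
  rw [integral_sub (integrable_eval_gaussianReal _) (integrable_eval_gaussianReal _),
    integral_sub (integrable_eval_gaussianReal _) (integrable_eval_gaussianReal _),
    integral_X_mul_gaussianReal]

open Polynomial in
theorem integral_hermite_mul_hermite_gaussianReal (m n : ℕ) :
    ∫ x, aeval x (hermite m) * aeval x (hermite n) ∂(gaussianReal 0 1)
      = if m = n then (n.factorial : ℝ) else 0 := by
  have key : ∀ m n : ℕ, ∫ x, ((hermite m).map (Int.castRingHom ℝ) *
      (hermite n).map (Int.castRingHom ℝ)).eval x ∂(gaussianReal 0 1)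
      = if m = n then (n.factorial : ℝ) else 0 := by
    intro m
    induction m with
    | zero =>
      intro n
      cases n with
      | zero => simp
      | succ n =>
        rw [mul_comm, integral_hermite_succ_mul_gaussianReal]
        simp
    | succ m ih =>
      intro n
      rw [integral_hermite_succ_mul_gaussianReal]
      cases n with
      | zero => simp
      | succ n =>
        rw [derivative_map, derivative_hermite_succ]
        have h : ∀ x : ℝ, ((hermite m).map (Int.castRingHom ℝ) *
            (((n : ℤ[X]) + 1) * hermite n).map (Int.castRingHom ℝ)).eval x
            = ((n : ℝ) + 1) * ((hermite m).map (Int.castRingHom ℝ) *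
              (hermite n).map (Int.castRingHom ℝ)).eval x := by
          intro x
          simp
          ring
        simp_rw [h]
        rw [integral_const_mul, ih]
        simp [Nat.factorial_succ]
  rw [← key m n]
  refine integral_congr_ae (ae_of_all _ fun x => ?_)
  simp [aeval_def, eval_map]

/-- The exponential generating function `∑ Heₙ(x) sⁿ tⁿ / n!`. -/
noncomputable def hermiteEGF (s x : ℝ) : PowerSeries ℝ :=
  PowerSeries.mk fun n => s ^ n * Polynomial.aeval x (Polynomial.hermite n) / (n.factorial : ℝ)

open PowerSeries in
theorem derivative_hermiteEGF (s x : ℝ) :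
    derivative ℝ (hermiteEGF s x) = (C (s * x) - C (s ^ 2) * X) * hermiteEGF s x := by
  ext n
  rw [coeff_derivative, sub_mul, map_sub, mul_assoc, coeff_C_mul, coeff_C_mul]
  cases n with
  | zero => simp [hermiteEGF]
  | succ n =>
    rw [coeff_succ_X_mul]
    simp only [hermiteEGF, coeff_mk]
    rw [Polynomial.hermite_succ (n + 1), derivative_hermite_succ]
    have h1 : (n.factorial : ℝ) ≠ 0 := by positivity
    have h2 : (n : ℝ) + 1 ≠ 0 := by positivity
    have h3 : (n : ℝ) + 1 + 1 ≠ 0 := by positivity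
    simp only [Nat.factorial_succ, map_sub, map_mul, Polynomial.aeval_X, map_add, map_one,
      map_natCast]
    push_cast
    field_simp
    ring

open PowerSeries in
theorem eq_of_derivative_eq_mul {f g p : PowerSeries ℝ}
    (hf : derivative ℝ f = p * f) (hg : derivative ℝ g = p * g)
    (h0 : constantCoeff f = constantCoeff g) : f = g := by
  ext n
  induction n using Nat.strong_induction_on with
  | _ n ih =>
    cases n with
    | zero => simpa using h0
    | succ n =>
      have h : coeff n (derivative ℝ f) = coeff n (derivative ℝ g) := by
        rw [hf, hg, coeff_mul, coeff_mul]
        refine Finset.sum_congr rfl fun q hq => ?_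
        rw [ih q.2 (by have := Finset.HasAntidiagonal.mem_antidiagonal.1 hq; omega)]
      rw [coeff_derivative, coeff_derivative] at h
      exact mul_right_cancel₀ (by positivity) h

open PowerSeries in
theorem prod_hermiteEGF {κ : Type*} (B : Finset κ) (w x : κ → ℝ) (hw : ∑ k ∈ B, w k ^ 2 = 1) :
    ∏ k ∈ B, hermiteEGF (w k) (x k) = hermiteEGF 1 (∑ k ∈ B, w k * x k) := by
  have hd : derivative ℝ (∏ k ∈ B, hermiteEGF (w k) (x k))
      = (C (∑ k ∈ B, w k * x k) - C (∑ k ∈ B, w k ^ 2) * X)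
        * ∏ k ∈ B, hermiteEGF (w k) (x k) := by
    clear hw
    induction B using Finset.induction_on with
    | empty => simp
    | insert k B hk ih =>
      rw [Finset.prod_insert hk, Derivation.leibniz, ih, derivative_hermiteEGF,
        Finset.sum_insert hk, Finset.sum_insert hk]
      simp only [smul_eq_mul, map_add]
      ring
  refine eq_of_derivative_eq_mul hd ?_ ?_
  · rw [derivative_hermiteEGF, hw]
    simp
  · rw [map_prod]
    simp [hermiteEGF, ← coeff_zero_eq_constantCoeff_apply]

/-- The addition formula for Hermite polynomials. -/
theorem aeval_hermite_sum {κ : Type*} (B : Finset κ) (w x : κ → ℝ)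
    (hw : ∑ k ∈ B, w k ^ 2 = 1) (n : ℕ) :
    Polynomial.aeval (∑ k ∈ B, w k * x k) (Polynomial.hermite n)
      = ∑ l ∈ B.finsuppAntidiag n, (n.factorial : ℝ) * ∏ k ∈ B,
        (w k ^ l k * Polynomial.aeval (x k) (Polynomial.hermite (l k)) / ((l k).factorial : ℝ)) := by
  have h := congrArg (PowerSeries.coeff n) (prod_hermiteEGF B w x hw)
  rw [PowerSeries.coeff_prod] at h
  simp only [hermiteEGF, PowerSeries.coeff_mk] at h
  rw [← Finset.mul_sum, h]
  have h1 : (n.factorial : ℝ) ≠ 0 := by positivity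
  field_simp
  simp

theorem sum_finsuppAntidiag_prod_ite {κ : Type*} (B : Finset κ) (b : κ → ℕ) (n : ℕ) (c : ℝ)
    (v : κ → ℝ) :
    ∑ l ∈ B.finsuppAntidiag n, c * ∏ k ∈ B, (if l k = b k then v k else 0)
      = if ∑ k ∈ B, b k = n then c * ∏ k ∈ B, v k else 0 := by
  split_ifs with h
  · have hb : ∀ k, Finsupp.indicator B (fun k _ => b k) k = if k ∈ B then b k else 0 := by
      intro k; simp [Finsupp.indicator_apply]
    rw [Finset.sum_eq_single (Finsupp.indicator B fun k _ => b k)]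
    · congr 1
      refine Finset.prod_congr rfl fun k hk => ?_
      rw [hb, if_pos hk, if_pos rfl]
    · intro l hl hne
      rw [Finset.mem_finsuppAntidiag] at hl
      have : ∃ k ∈ B, l k ≠ b k := by
        by_contra! hc
        refine hne (Finsupp.ext fun k => ?_)
        rw [hb]
        split_ifs with hk
        · exact hc k hk
        · exact Finsupp.notMem_support_iff.1 fun hs => hk (hl.2 hs)
      obtain ⟨k, hk, hkb⟩ := this
      rw [Finset.prod_eq_zero hk (if_neg hkb), mul_zero]
    · intro hn
      refine absurd ?_ hn
      rw [Finset.mem_finsuppAntidiag]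
      refine ⟨?_, Finsupp.support_indicator_subset _ _⟩
      rw [← h]
      exact Finset.sum_congr rfl fun k hk => by rw [hb, if_pos hk]
  · refine Finset.sum_eq_zero fun l hl => ?_
    rw [Finset.mem_finsuppAntidiag] at hl
    have : ∃ k ∈ B, l k ≠ b k := by
      by_contra! hc
      exact h (by rw [← hl.1]; exact (Finset.sum_congr rfl hc).symm)
    obtain ⟨k, hk, hkb⟩ := this
    rw [Finset.prod_eq_zero hk (if_neg hkb), mul_zero]

theorem integrable_hermite_mul_hermite_gaussianReal (c : ℝ) (m n : ℕ) :
    Integrable (fun x : ℝ => c * (Polynomial.aeval x (Polynomial.hermite m)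
      * Polynomial.aeval x (Polynomial.hermite n))) (gaussianReal 0 1) := by
  refine Integrable.const_mul ?_ _
  convert! integrable_eval_gaussianReal ((Polynomial.hermite m).map (Int.castRingHom ℝ) *
      (Polynomial.hermite n).map (Int.castRingHom ℝ)) using 2 with x
  simp [Polynomial.aeval_def, Polynomial.eval_map]

theorem integral_prod_hermite_weighted_sums {ι κ : Type*} [Fintype ι] [DecidableEq ι]
    [Fintype κ] (g : κ → ι)
    (w : κ → ℝ) (hw : ∀ i, ∑ k with g k = i, w k ^ 2 = 1) (a : ι → ℕ) (b : κ → ℕ) :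
    ∫ x : κ → ℝ,
        (∏ i, Polynomial.aeval (∑ k with g k = i, w k * x k) (Polynomial.hermite (a i))) *
          ∏ k, Polynomial.aeval (x k) (Polynomial.hermite (b k))
        ∂(Measure.pi fun _ : κ => gaussianReal 0 1)
      = ∏ i, if ∑ k with g k = i, b k = a i then
          ((a i).factorial : ℝ) * ∏ k with g k = i, w k ^ b k else 0 := by
  have expand (x : κ → ℝ) :
      (∏ i, Polynomial.aeval (∑ k with g k = i, w k * x k) (Polynomial.hermite (a i))) *
          ∏ k, Polynomial.aeval (x k) (Polynomial.hermite (b k))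
      = ∑ p ∈ Fintype.piFinset fun i => (univ.filter (g · = i)).finsuppAntidiag (a i),
          (∏ i, ((a i).factorial : ℝ)) * ∏ k, (w k ^ p (g k) k / ((p (g k) k).factorial : ℝ) *
            (Polynomial.aeval (x k) (Polynomial.hermite (p (g k) k)) *
              Polynomial.aeval (x k) (Polynomial.hermite (b k)))) := by
    simp_rw [fun i => aeval_hermite_sum _ w x (hw i) (a i)]
    rw [Finset.prod_univ_sum, Finset.sum_mul]
    refine Finset.sum_congr rfl fun p _ => ?_
    rw [Finset.prod_mul_distrib, mul_assoc]
    congr 1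
    rw [← Finset.prod_fiberwise univ g fun k => _, ← Finset.prod_fiberwise univ g fun k => _,
      ← Finset.prod_mul_distrib]
    refine Finset.prod_congr rfl fun i _ => ?_
    rw [← Finset.prod_mul_distrib]
    refine Finset.prod_congr rfl fun k hk => ?_
    rw [(Finset.mem_filter.1 hk).2]
    ring
  simp_rw [expand]
  rw [integral_finsetSum _ fun p _ => Integrable.const_mul (Integrable.fintype_prod
    fun k => integrable_hermite_mul_hermite_gaussianReal _ _ _) _]
  simp_rw [← sum_finsuppAntidiag_prod_ite]
  rw [Finset.prod_univ_sum]
  refine Finset.sum_congr rfl fun p _ => ?_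
  rw [integral_const_mul, Finset.prod_mul_distrib]
  congr 1
  rw [integral_fintype_prod_eq_prod (f := fun k y => w k ^ p (g k) k / ((p (g k) k).factorial : ℝ) *
            (Polynomial.aeval y (Polynomial.hermite (p (g k) k)) *
              Polynomial.aeval y (Polynomial.hermite (b k)))),
    ← Finset.prod_fiberwise univ g]
  refine Finset.prod_congr rfl fun i _ => Finset.prod_congr rfl fun k hk => ?_
  rw [(Finset.mem_filter.1 hk).2, integral_const_mul, integral_hermite_mul_hermite_gaussianReal]
  split_ifs with h
  · rw [h]
    field_simp
  · simp

theorem filter_block_eq_filter_divNat (N₀ N₁ : ℕ) (hN₁ : 0 < N₁) (i : Fin N₀) :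
    univ.filter (fun k : Fin (N₀ * N₁) => (i : ℕ) * N₁ ≤ (k : ℕ) ∧ (k : ℕ) < ((i : ℕ) + 1) * N₁)
      = univ.filter (fun k : Fin (N₀ * N₁) => k.divNat = i) := by
  ext k
  simp only [Finset.mem_filter, Finset.mem_univ, true_and, Fin.ext_iff, Fin.coe_divNat]
  rw [Nat.div_eq_iff hN₁, add_mul]
  omega

theorem multiIndexMatches_iff (N₀ N₁ : ℕ) (hN₁ : 0 < N₁) (a : Fin N₀ → ℕ)
    (a' : Fin (N₀ * N₁) → ℕ) :
    MultiIndexMatches N₀ N₁ a a'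
      ↔ ∀ i, ∑ k : Fin (N₀ * N₁) with k.divNat = i, a' k = a i := by
  have hpre (i : Fin N₀) :
      ∑ k ∈ univ.filter (fun k : Fin (N₀ * N₁) => (k : ℕ) < ((i : ℕ) + 1) * N₁), a' k
        = ∑ j with j ≤ i, ∑ k : Fin (N₀ * N₁) with k.divNat = j, a' k := by
    have hset : univ.filter (fun k : Fin (N₀ * N₁) => (k : ℕ) < ((i : ℕ) + 1) * N₁)
        = univ.filter (fun k : Fin (N₀ * N₁) => k.divNat ≤ i) := by
      ext k
      simp only [Finset.mem_filter, Finset.mem_univ, true_and, Fin.le_def, Fin.coe_divNat]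
      rw [← Nat.lt_add_one_iff, Nat.div_lt_iff_lt_mul hN₁]
    rw [hset, ← Finset.sum_fiberwise_of_maps_to (g := Fin.divNat) (t := univ.filter (· ≤ i))
      (fun k hk => by simpa using hk)]
    refine Finset.sum_congr rfl fun j hj => Finset.sum_congr ?_ fun _ _ => rfl
    ext k
    have := (Finset.mem_filter.1 hj).2
    simp only [Finset.mem_filter, Finset.mem_univ, true_and, and_iff_right_iff_imp]
    rintro rfl
    exact this
  have hstep (f : Fin N₀ → ℕ) (i : Fin N₀) :
      ∑ j with j ≤ i, f j = f i + ∑ j with j < i, f j := by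
    have hset : univ.filter (· ≤ i) = insert i (univ.filter (· < i)) := by
      ext j
      simp [le_iff_eq_or_lt]
    rw [hset, Finset.sum_insert (by simp)]
  simp only [MultiIndexMatches, hpre]
  constructor
  · intro h i
    induction i using WellFoundedLT.induction with
    | _ i ih =>
      have hi := h i
      rw [hstep, hstep a, Finset.sum_congr rfl fun j hj => ih j (Finset.mem_filter.1 hj).2] at hi
      exact Nat.add_right_cancel hi
  · intro h i
    exact Finset.sum_congr rfl fun j _ => h j

theorem card_filter_divNat_eq (N₀ N₁ : ℕ) (i : Fin N₀) :
    (univ.filter fun k : Fin (N₀ * N₁) => k.divNat = i).card = N₁ := by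
  rw [Finset.card_filter, ← finProdFinEquiv.sum_comp, Fintype.sum_prod_type]
  have h (p : Fin N₀ × Fin N₁) : (finProdFinEquiv p).divNat = p.1 :=
    congrArg Prod.fst (finProdFinEquiv.symm_apply_apply p)
  simp [h]

theorem div_sqrt_mul_sqrt_eq {x y : ℝ} (hx : 0 < x) (hy : 0 < y) (z : ℝ) :
    x * z / (√x * √y) = √(x / y) * z := by
  rw [Real.sqrt_div hx.le]
  have h1 : √x ≠ 0 := by positivity
  have h2 : √y ≠ 0 := by positivity
  field_simp
  rw [Real.sq_sqrt hx.le, mul_comm]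

theorem rpow_neg_natCast_div_two {x : ℝ} (hx : 0 < x) (n : ℕ) :
    x ^ (-(n : ℝ) / 2) = (1 / √x) ^ n := by
  rw [one_div, inv_pow, Real.sqrt_eq_rpow, ← Real.rpow_natCast, ← Real.rpow_mul hx.le,
    ← Real.rpow_neg hx.le]
  congr 1
  ring

/-- For the standard Gaussian product measure `γ` on `ℝ^{N₀N₁}`,
`∫ (Π_i Ĥ_{a_i}(Y_i(x))) (Π_j Ĥ_{a'_j}(x_j)) dγ(x)` equals `√(a!/a'!) · N₁^{-|a|/2}` if
`a'` matches `a`, and `0` otherwise. -/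
theorem gaussian_integral_hermite_block_products (N₀ N₁ : ℕ) (hN₀ : 0 < N₀) (hN₁ : 0 < N₁)
    (a : Fin N₀ → ℕ) (a' : Fin (N₀ * N₁) → ℕ) :
    ∫ x : Fin (N₀ * N₁) → ℝ,
        (∏ i, normalizedHermite (a i) (blockAverage N₀ N₁ i x)) *
          (∏ j, normalizedHermite (a' j) (x j))
        ∂(Measure.pi fun _ : Fin (N₀ * N₁) => gaussianReal 0 1)
      = if MultiIndexMatches N₀ N₁ a a' then
          Real.sqrt ((∏ i, Nat.factorial (a i) : ℕ) / (∏ j, Nat.factorial (a' j) : ℕ) : ℝ) *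
            (N₁ : ℝ) ^ (-((∑ i, a i : ℕ) : ℝ) / 2)
        else 0 := by
  set c : ℝ := 1 / √(N₁ : ℝ) with hc
  have hN : (0 : ℝ) < N₁ := by exact_mod_cast hN₁
  have hw (i : Fin N₀) : ∑ k : Fin (N₀ * N₁) with k.divNat = i, c ^ 2 = 1 := by
    rw [Finset.sum_const, card_filter_divNat_eq, nsmul_eq_mul, hc, div_pow, Real.sq_sqrt hN.le]
    field_simp
  have hint (x : Fin (N₀ * N₁) → ℝ) :
      (∏ i, normalizedHermite (a i) (blockAverage N₀ N₁ i x)) *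
          (∏ j, normalizedHermite (a' j) (x j))
        = ((∏ i, Polynomial.aeval (∑ k with k.divNat = i, c * x k) (Polynomial.hermite (a i))) *
          ∏ k, Polynomial.aeval (x k) (Polynomial.hermite (a' k))) /
            (√(∏ i, ((a i).factorial : ℝ)) * √(∏ j, ((a' j).factorial : ℝ))) := by
    simp only [normalizedHermite, blockAverage, filter_block_eq_filter_divNat _ _ hN₁,
      Finset.prod_div_distrib, Finset.mul_sum]
    rw [Real.sqrt_prod _ fun i _ => by positivity, Real.sqrt_prod _ fun i _ => by positivity,
      div_mul_div_comm]
  simp_rw [hint]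
  rw [integral_div, integral_prod_hermite_weighted_sums (fun k : Fin (N₀ * N₁) => k.divNat)
    (fun _ => c) hw a a', multiIndexMatches_iff _ _ hN₁]
  split_ifs with h
  · have hprod : (∏ i, if ∑ k : Fin (N₀ * N₁) with k.divNat = i, a' k = a i then
          ((a i).factorial : ℝ) * ∏ k : Fin (N₀ * N₁) with k.divNat = i, c ^ a' k else 0)
        = (∏ i, ((a i).factorial : ℝ)) * c ^ ∑ i, a i := by
      rw [← Finset.prod_pow_eq_pow_sum, ← Finset.prod_mul_distrib]
      refine Finset.prod_congr rfl fun i _ => ?_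
      rw [if_pos (h i), Finset.prod_pow_eq_pow_sum, h i]
    rw [hprod, rpow_neg_natCast_div_two hN, div_sqrt_mul_sqrt_eq
      (Finset.prod_pos fun i _ => by positivity) (Finset.prod_pos fun i _ => by positivity)]
    push_cast
    rfl
  · push Not at h
    obtain ⟨i, hi⟩ := h
    rw [Finset.prod_eq_zero (Finset.mem_univ i) (if_neg hi), zero_div]
end

section
/- Let L, ℓ, ℓ' be positive integers, let (u_i)_{i=1}^{ℓ} and (v_j)_{j=1}^{ℓ'} each be orthonormal families of vectors in Euclidean space ℝ^L, and let γ_L be the standard Gaussian product measure on ℝ^L. Then for all multi-indices a ∈ ℤ₊^ℓ and a' ∈ ℤ₊^{ℓ'}, ∫ (Π_{i=1}^{ℓ} Ĥ_{a_i}(⟨u_i, x⟩)) · (Π_{j=1}^{ℓ'} Ĥ_{a'_j}(⟨v_j, x⟩)) dγ_L(x) = √(a! · a'!) · Σ_{(k_{ij})} Π_{i=1}^{ℓ} Π_{j=1}^{ℓ'} ⟨u_i, v_j⟩^{k_{ij}} / k_{ij}!, where the sum is over all matrices (k_{ij}) ∈ ℤ₊^{ℓ×ℓ'} satisfying Σ_{j=1}^{ℓ'}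 k_{ij} = a_i for every i and Σ_{i=1}^{ℓ} k_{ij} = a'_j for every j. In particular, the integral is 0 when |a| ≠ |a'| (the index set of the sum being empty). -/
open MeasureTheory ProbabilityTheory Finset

theorem sub_single_add_single {ι : Type*} [DecidableEq ι] {a : ι → ℕ} {i : ι} (h : a i ≠ 0) :
    a - Pi.single i 1 + Pi.single i 1 = a := by
  refine tsub_add_cancel_of_le fun i' => ?_
  by_cases hi : i' = i
  · subst hi; simp; omega
  · simp [hi]

/-- The sum of `∏ i, ∏ j, c i j ^ K i j / (K i j)!` over the matrices `K` of natural numbers with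
row sums `a` and column sums `b`. -/
noncomputable def contingencySum {ι κ : Type*} [Fintype ι] [Fintype κ] (c : ι → κ → ℝ)
    (a : ι → ℕ) (b : κ → ℕ) : ℝ :=
  ∑' K : {K : ι → κ → ℕ // (∀ i, ∑ j, K i j = a i) ∧ (∀ j, ∑ i, K i j = b j)},
    ∏ i, ∏ j, c i j ^ (K.1 i j) / (Nat.factorial (K.1 i j) : ℝ)

section Contingency

variable {ι κ : Type*} [Fintype ι] [Fintype κ]

theorem finite_setOf_row_col_sums (a : ι → ℕ) (b : κ → ℕ) :
    {K : ι → κ → ℕ | (∀ i, ∑ j, K i j = a i) ∧ (∀ j, ∑ i, K i j = b j)}.Finite := by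
  classical
  refine (Set.finite_Icc (0 : ι → κ → ℕ) fun i _ => a i).subset fun K hK => ⟨zero_le, fun i j => ?_⟩
  refine le_of_le_of_eq ?_ (hK.1 i)
  exact single_le_sum (f := K i) (fun _ _ => zero_le) (mem_univ j)

theorem contingencySum_zero_zero (c : ι → κ → ℝ) : contingencySum c 0 0 = 1 := by
  unfold contingencySum
  rw [tsum_eq_single ⟨0, by simp⟩]
  · simp
  · rintro ⟨K, hK⟩ h
    refine (h (Subtype.ext ?_)).elim
    ext i j
    have := hK.1 i
    simp only [Pi.zero_apply, sum_eq_zero_iff, mem_univ, true_imp_iff] at this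
    exact this j

theorem contingencySum_eq_zero_of_sum_ne (c : ι → κ → ℝ) {a : ι → ℕ} {b : κ → ℕ}
    (h : ∑ i, a i ≠ ∑ j, b j) : contingencySum c a b = 0 := by
  have : IsEmpty {K : ι → κ → ℕ // (∀ i, ∑ j, K i j = a i) ∧ (∀ j, ∑ i, K i j = b j)} := by
    refine ⟨fun ⟨K, hr, hc⟩ => h ?_⟩
    simp_rw [← hr, ← hc]
    exact sum_comm
  exact tsum_empty

variable [DecidableEq ι] [DecidableEq κ]

theorem prod_pow_div_factorial_add_single (c : ι → κ → ℝ) (K : ι → κ → ℕ) (i : ι) (j : κ) :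
    ((K i j : ℝ) + 1) * ∏ i', ∏ j',
        c i' j' ^ ((K + Pi.single i (Pi.single j 1) : ι → κ → ℕ) i' j') /
          (Nat.factorial ((K + Pi.single i (Pi.single j 1) : ι → κ → ℕ) i' j') : ℝ) =
      c i j * ∏ i', ∏ j', c i' j' ^ (K i' j') / (Nat.factorial (K i' j') : ℝ) := by
  simp_rw [← Fintype.prod_prod_type']
  rw [← mul_prod_erase univ _ (mem_univ (i, j)), ← mul_prod_erase univ _ (mem_univ (i, j)),
    prod_congr rfl (g := fun p : ι × κ => c p.1 p.2 ^ (K p.1 p.2) / (Nat.factorial (K p.1 p.2) : ℝ))]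
  · simp only [Pi.add_apply, Pi.single_eq_same, Nat.factorial_succ, pow_succ]
    push_cast
    field_simp
  · rintro ⟨i', j'⟩ hp
    have h0 : (Pi.single i (Pi.single j 1) : ι → κ → ℕ) i' j' = 0 := by
      by_cases hi : i' = i
      · subst hi
        have : j' ≠ j := by rintro rfl; simp at hp
        simp [this]
      · simp [hi]
    simp only [Pi.add_apply, h0, add_zero]

theorem row_col_sums_add_single_iff (a : ι → ℕ) (b : κ → ℕ) (K : ι → κ → ℕ) (i : ι) (j : κ) :
    ((∀ i', ∑ j', (K + Pi.single i (Pi.single j 1) : ι → κ → ℕ) i' j' = (a + Pi.single i 1 : ι → ℕ) i') ∧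
      (∀ j', ∑ i', (K + Pi.single i (Pi.single j 1) : ι → κ → ℕ) i' j' = b j')) ↔
    b j ≠ 0 ∧ (∀ i', ∑ j', K i' j' = a i') ∧ (∀ j', ∑ i', K i' j' = (b - Pi.single j 1 : κ → ℕ) j') := by
  have hr (i') : ∑ j', (Pi.single i (Pi.single j 1) : ι → κ → ℕ) i' j' =
      (Pi.single i 1 : ι → ℕ) i' := by
    by_cases hi : i' = i
    · subst hi; simp
    · simp [hi]
  have hc (j') : ∑ i', (Pi.single i (Pi.single j 1) : ι → κ → ℕ) i' j' =
      (Pi.single j 1 : κ → ℕ) j' := by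
    rw [Fintype.sum_eq_single i fun i' hi' => by simp [hi'], Pi.single_eq_same]
  simp only [Pi.add_apply, sum_add_distrib, hr, hc, add_left_inj, Pi.sub_apply]
  constructor
  · rintro ⟨h1, h2⟩
    refine ⟨?_, h1, fun j' => ?_⟩
    · have := h2 j
      simp only [Pi.single_eq_same] at this
      omega
    · rw [← h2 j']; simp
  · rintro ⟨hb, h1, h2⟩
    refine ⟨h1, fun j' => ?_⟩
    rw [h2 j']
    by_cases hj : j' = j
    · subst hj; simp; omega
    · simp [hj]

theorem contingencySum_add_single (c : ι → κ → ℝ) (a : ι → ℕ) (b : κ → ℕ) (i : ι) :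
    ((a i : ℝ) + 1) * contingencySum c (a + Pi.single i 1) b =
      ∑ j, c i j * if b j = 0 then 0 else contingencySum c a (b - Pi.single j 1) := by
  let M (a : ι → ℕ) (b : κ → ℕ) : Set (ι → κ → ℕ) :=
    {K | (∀ i, ∑ j, K i j = a i) ∧ (∀ j, ∑ i, K i j = b j)}
  let w (K : ι → κ → ℕ) : ℝ := ∏ i, ∏ j, c i j ^ (K i j) / (Nat.factorial (K i j) : ℝ)
  have hS (a b) : contingencySum c a b = ∑' K, (M a b).indicator w K := tsum_subtype (M a b) w
  have hrow (K) : ((a i : ℝ) + 1) * (M (a + Pi.single i 1) b).indicator w K =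
      ∑ j, (K i j : ℝ) * (M (a + Pi.single i 1) b).indicator w K := by
    by_cases hK : K ∈ M (a + Pi.single i 1) b
    · have : ∑ j, (K i j : ℝ) = a i + 1 := by exact_mod_cast (by simpa using hK.1 i)
      rw [← sum_mul, this]
    · simp [hK]
  rw [hS, ← tsum_mul_left]
  simp_rw [hrow]
  rw [Summable.tsum_finsetSum]
  · refine sum_congr rfl fun j _ => ?_
    let g : (ι → κ → ℕ) → (ι → κ → ℕ) := fun K => K + Pi.single i (Pi.single j 1)
    have hg : Function.Injective g := add_left_injective _
    rw [← hg.tsum_eq]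
    · have hite : (if b j = 0 then 0 else contingencySum c a (b - Pi.single j 1)) =
          ∑' K, if b j = 0 then 0 else (M a (b - Pi.single j 1)).indicator w K := by
        split_ifs <;> simp [hS]
      rw [hite, ← tsum_mul_left]
      refine tsum_congr fun K => ?_
      have hw := prod_pow_div_factorial_add_single c K i j
      have hM := row_col_sums_add_single_iff a b K i j
      by_cases hK : g K ∈ M (a + Pi.single i 1) b
      · obtain ⟨hb, hK'⟩ := hM.1 hK
        have hK' : K ∈ M a (b - Pi.single j 1) := hK'
        rw [Set.indicator_of_mem hK, if_neg hb, Set.indicator_of_mem hK']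
        simp only [g, Pi.add_apply, Pi.single_eq_same, Nat.cast_add, Nat.cast_one]
        exact hw
      · rw [Set.indicator_of_notMem hK, mul_zero]
        by_cases hb : b j = 0
        · simp [hb]
        · have hK' : K ∉ M a (b - Pi.single j 1) := fun h => hK (hM.2 ⟨hb, h⟩)
          rw [if_neg hb, Set.indicator_of_notMem hK', mul_zero]
    · intro K hK
      have hKij : K i j ≠ 0 := by rintro h; simp [h] at hK
      refine ⟨K - Pi.single i (Pi.single j 1), ?_⟩
      refine tsub_add_cancel_of_le fun i' j' => ?_
      by_cases hi : i' = i
      · subst hi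
        by_cases hj : j' = j
        · subst hj; simp; omega
        · simp [hj]
      · simp [hi]
  · intro j _
    refine summable_of_hasFiniteSupport ((finite_setOf_row_col_sums (a + Pi.single i 1) b).subset ?_)
    intro K hK
    by_contra h
    have h' : K ∉ M (a + Pi.single i 1) b := h
    simp [h'] at hK

theorem prod_factorial_add_single (a : ι → ℕ) (i : ι) :
    ∏ i', Nat.factorial ((a + Pi.single i 1 : ι → ℕ) i') = (a i + 1) * ∏ i', Nat.factorial (a i') := by
  rw [← mul_prod_erase univ _ (mem_univ i), ← mul_prod_erase univ _ (mem_univ i), ← mul_assoc,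
    prod_congr rfl (g := fun i' => Nat.factorial (a i'))]
  · simp [Nat.factorial_succ]
  · intro i' hi'
    simp [ne_of_mem_erase hi']

theorem factorial_mul_contingencySum_add_single (c : ι → κ → ℝ) (a : ι → ℕ) (b : κ → ℕ) (i : ι) :
    ((∏ i', Nat.factorial ((a + Pi.single i 1 : ι → ℕ) i') : ℕ) : ℝ) * (∏ j, Nat.factorial (b j) : ℕ) *
        contingencySum c (a + Pi.single i 1) b =
      ∑ j, c i j * (b j * ((∏ i', Nat.factorial (a i') : ℕ) *
        (∏ j', Nat.factorial ((b - Pi.single j 1 : κ → ℕ) j') : ℕ) *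
          contingencySum c a (b - Pi.single j 1))) := by
  have h := contingencySum_add_single c a b i
  rw [prod_factorial_add_single, Nat.cast_mul, Nat.cast_add, Nat.cast_one,
    show ∀ x y z t : ℝ, x * y * z * t = y * z * (x * t) by intros; ring, h, mul_sum]
  refine sum_congr rfl fun j _ => ?_
  by_cases hb : b j = 0
  · simp [hb]
  · have hf := prod_factorial_add_single (b - Pi.single j 1) j
    rw [sub_single_add_single hb] at hf
    have : (b - Pi.single j 1 : κ → ℕ) j + 1 = b j := by simp; omega
    rw [this] at hf
    rw [if_neg hb, hf]
    push_cast
    ring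

end Contingency

theorem integrable_pow_gaussianReal (n : ℕ) :
    Integrable (fun x : ℝ => x ^ n) (gaussianReal 0 1) := by
  have h := (memLp_id_gaussianReal (μ := 0) (v := 1) n).integrable_norm_pow' (f := id)
  refine h.mono (by fun_prop) ?_
  simp

theorem integral_pow_succ_gaussianReal (n : ℕ) :
    ∫ x, x ^ (n + 1) ∂(gaussianReal 0 1) = n * ∫ x, x ^ (n - 1) ∂(gaussianReal 0 1) := by
  have hint (m : ℕ) : Integrable (fun x : ℝ => x ^ m * gaussianPDFReal 0 1 x) := by
    have h := integrable_pow_gaussianReal m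
    rw [gaussianReal_of_var_ne_zero _ one_ne_zero,
      integrable_withDensity_iff (measurable_gaussianPDF _ _)
        (ae_of_all _ fun _ => gaussianPDF_lt_top)] at h
    simpa [toReal_gaussianPDF] using h
  have hderiv (x : ℝ) : HasDerivAt (gaussianPDFReal 0 1) (-(x * gaussianPDFReal 0 1 x)) x := by
    unfold gaussianPDFReal
    have := ((hasDerivAt_pow 2 x).fun_neg.div_const 2).exp.const_mul (Real.sqrt (2 * Real.pi))⁻¹
    convert! this using 1
    · simp
    · simp; ring
  have key := integral_mul_deriv_eq_deriv_mul_of_integrable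
    (u := fun x : ℝ => x ^ n) (u' := fun x => n * x ^ (n - 1))
    (v := gaussianPDFReal 0 1) (v' := fun x => -(x * gaussianPDFReal 0 1 x))
    (fun x _ => hasDerivAt_pow n x) (fun x _ => hderiv x)
    (by
      refine (hint (n + 1)).neg.congr (ae_of_all _ fun x => ?_)
      simp; ring)
    (by
      refine ((hint (n - 1)).const_mul (n : ℝ)).congr (ae_of_all _ fun x => ?_)
      simp; ring)
    (hint n)
  rw [integral_gaussianReal_eq_integral_smul one_ne_zero,
    integral_gaussianReal_eq_integral_smul one_ne_zero, ← integral_const_mul]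
  have hl : ∫ x, gaussianPDFReal 0 1 x • x ^ (n + 1) =
      -∫ x, x ^ n * -(x * gaussianPDFReal 0 1 x) := by
    rw [← integral_neg]
    refine integral_congr_ae (ae_of_all _ fun x => ?_)
    simp; ring
  rw [hl, key, neg_neg]
  refine integral_congr_ae (ae_of_all _ fun x => ?_)
  simp; ring

theorem derivative_hermite (n : ℕ) :
    (Polynomial.hermite n).derivative = (n : Polynomial ℤ) * Polynomial.hermite (n - 1) := by
  induction n with
  | zero => simp
  | succ n ih =>
    cases n with
    | zero => simp
    | succ n =>
      rw [Polynomial.hermite_succ (n + 1), ih, Polynomial.derivative_sub, Polynomial.derivative_mul,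
        Polynomial.derivative_mul, ih]
      simp only [Nat.add_sub_cancel, Polynomial.derivative_X, Polynomial.derivative_natCast]
      rw [Polynomial.hermite_succ n]
      push_cast
      ring

theorem Derivation.leibniz_finset_prod {R A : Type*} [CommSemiring R] [CommSemiring A]
    [Algebra R A] {ι : Type*} [DecidableEq ι] (D : Derivation R A A) (s : Finset ι) (f : ι → A) :
    D (∏ i ∈ s, f i) = ∑ i ∈ s, (∏ j ∈ s.erase i, f j) * D (f i) := by
  induction s using Finset.induction_on with
  | empty => simp
  | insert i s hi ih =>
    rw [prod_insert hi, D.leibniz, ih, sum_insert hi, erase_insert hi, add_comm, smul_eq_mul,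
      smul_eq_mul, mul_sum]
    congr 1
    refine sum_congr rfl fun j hj => ?_
    have hij : i ≠ j := by rintro rfl; exact hi hj
    rw [erase_insert_of_ne hij, prod_insert (by simp [hi]), mul_assoc]

section GaussianExpectation

variable {σ : Type*} [Fintype σ]

theorem eval_monomial_eq_smul_prod (m : σ →₀ ℕ) (r : ℝ) (x : σ → ℝ) :
    MvPolynomial.eval x (MvPolynomial.monomial m r) = r * ∏ k, x k ^ m k := by
  rw [MvPolynomial.eval_monomial, Finsupp.prod_fintype _ _ (by simp)]

theorem integrable_eval_pi_gaussianReal (p : MvPolynomial σ ℝ) :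
    Integrable (fun x => MvPolynomial.eval x p) (Measure.pi fun _ : σ => gaussianReal 0 1) := by
  induction p using MvPolynomial.induction_on' with
  | monomial m r =>
    simp_rw [eval_monomial_eq_smul_prod]
    exact (Integrable.fintype_prod (f := fun k y => y ^ m k)
      fun k => integrable_pow_gaussianReal (m k)).const_mul r
  | add p q hp hq => simpa only [map_add] using! hp.add hq

/-- The expectation of a polynomial in independent standard Gaussian variables. -/
noncomputable def gaussianExpectation (σ : Type*) [Fintype σ] : MvPolynomial σ ℝ →ₗ[ℝ] ℝ where
  toFun p := ∫ x, MvPolynomial.eval x p ∂(Measure.pi fun _ : σ => gaussianReal 0 1)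
  map_add' p q := by
    simp only [map_add]
    exact integral_add (integrable_eval_pi_gaussianReal p) (integrable_eval_pi_gaussianReal q)
  map_smul' r p := by
    simp [MvPolynomial.smul_eval, integral_const_mul]

theorem gaussianExpectation_one : gaussianExpectation σ 1 = 1 := by
  simp [gaussianExpectation]

theorem gaussianExpectation_monomial (m : σ →₀ ℕ) (r : ℝ) :
    gaussianExpectation σ (MvPolynomial.monomial m r) =
      r * ∏ k, ∫ y, y ^ m k ∂(gaussianReal 0 1) := by
  simp only [gaussianExpectation, LinearMap.coe_mk, AddHom.coe_mk, eval_monomial_eq_smul_prod]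
  rw [integral_const_mul, integral_fintype_prod_eq_prod (f := fun k y => y ^ m k)]

theorem gaussianExpectation_X_mul (k : σ) (p : MvPolynomial σ ℝ) :
    gaussianExpectation σ (MvPolynomial.X k * p) =
      gaussianExpectation σ (MvPolynomial.pderiv k p) := by
  classical
  induction p using MvPolynomial.induction_on' with
  | monomial m r =>
    rw [MvPolynomial.pderiv_monomial, MvPolynomial.X, MvPolynomial.monomial_mul, one_mul,
      gaussianExpectation_monomial, gaussianExpectation_monomial,
      ← mul_prod_erase univ _ (mem_univ k), ← mul_prod_erase univ _ (mem_univ k),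
      prod_congr rfl (g := fun l => ∫ y, y ^ m l ∂(gaussianReal 0 1)),
      prod_congr (s₁ := univ.erase k) rfl (f := fun l => ∫ y, y ^ (m - _) l ∂(gaussianReal 0 1))
        (g := fun l => ∫ y, y ^ m l ∂(gaussianReal 0 1))]
    · simp only [Finsupp.add_apply, Finsupp.tsub_apply, Finsupp.single_eq_same]
      rw [add_comm 1, integral_pow_succ_gaussianReal]
      ring
    · intro l hl
      simp [(ne_of_mem_erase hl).symm]
    · intro l hl
      simp [(ne_of_mem_erase hl).symm]
  | add p q hp hq => simp [mul_add, hp, hq]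

/-- The linear form `∑ k, u k * X k`. -/
noncomputable def linearForm (u : σ → ℝ) : MvPolynomial σ ℝ := ∑ k, u k • MvPolynomial.X k

/-- The derivative in the direction `u`. -/
noncomputable def dirDeriv (u : σ → ℝ) :
    Derivation ℝ (MvPolynomial σ ℝ) (MvPolynomial σ ℝ) := ∑ k, u k • MvPolynomial.pderiv k

theorem dirDeriv_apply (u : σ → ℝ) (p : MvPolynomial σ ℝ) :
    dirDeriv u p = ∑ k, u k • MvPolynomial.pderiv k p := by
  change (Derivation.coeFnAddMonoidHom (∑ k, u k • MvPolynomial.pderiv k)) p = _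
  rw [map_sum, Finset.sum_apply]
  rfl

theorem dirDeriv_linearForm (u v : σ → ℝ) :
    dirDeriv u (linearForm v) = MvPolynomial.C (∑ k, u k * v k) := by
  classical
  simp [dirDeriv_apply, linearForm, MvPolynomial.pderiv_X, Pi.single_apply, MvPolynomial.smul_eq_C_mul,
    mul_comm]

theorem gaussianExpectation_linearForm_mul (u : σ → ℝ) (p : MvPolynomial σ ℝ) :
    gaussianExpectation σ (linearForm u * p) = gaussianExpectation σ (dirDeriv u p) := by
  simp [linearForm, dirDeriv_apply, sum_mul, gaussianExpectation_X_mul]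

theorem dirDeriv_aeval_hermite (u v : σ → ℝ) (n : ℕ) :
    dirDeriv u (Polynomial.aeval (linearForm v) (Polynomial.hermite n)) =
      ((∑ k, u k * v k) * n) • Polynomial.aeval (linearForm v) (Polynomial.hermite (n - 1)) := by
  have h := ((dirDeriv u).restrictScalars ℤ).map_aeval (Polynomial.hermite n) (linearForm v)
  simp only [Derivation.coe_restrictScalars] at h
  rw [h, dirDeriv_linearForm, derivative_hermite]
  simp only [map_mul, map_natCast, smul_eq_mul, MvPolynomial.smul_eq_C_mul]
  ring

/-- The product of the Hermite polynomials of degrees `a i` in the linear forms of the `u i`. -/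
noncomputable def hermiteProd {ι : Type*} [Fintype ι] (u : ι → σ → ℝ) (a : ι → ℕ) :
    MvPolynomial σ ℝ :=
  ∏ i, Polynomial.aeval (linearForm (u i)) (Polynomial.hermite (a i))

variable {ι κ : Type*} [Fintype ι] [Fintype κ] [DecidableEq ι] [DecidableEq κ]

theorem hermiteProd_eq_mul_prod_erase (u : ι → σ → ℝ) (i : ι) {a a' : ι → ℕ}
    (h : ∀ i', i' ≠ i → a' i' = a i') :
    hermiteProd u a' = Polynomial.aeval (linearForm (u i)) (Polynomial.hermite (a' i)) *
      ∏ i' ∈ univ.erase i, Polynomial.aeval (linearForm (u i')) (Polynomial.hermite (a i')) := by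
  rw [hermiteProd, ← mul_prod_erase univ _ (mem_univ i)]
  congr 1
  exact prod_congr rfl fun i' hi' => by rw [h i' (ne_of_mem_erase hi')]

theorem dirDeriv_hermiteProd (w : σ → ℝ) (v : κ → σ → ℝ) (b : κ → ℕ) :
    dirDeriv w (hermiteProd v b) =
      ∑ j, ((∑ k, w k * v j k) * b j) • hermiteProd v (b - Pi.single j 1) := by
  rw [hermiteProd, Derivation.leibniz_finset_prod]
  refine sum_congr rfl fun j _ => ?_
  rw [dirDeriv_aeval_hermite, mul_smul_comm, mul_comm (∏ j' ∈ _, _),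
    hermiteProd_eq_mul_prod_erase v j (a := b) fun _ h => by simp [h]]
  simp

theorem hermiteProd_add_single {u : ι → σ → ℝ}
    (hu : ∀ i i', ∑ k, u i k * u i' k = if i = i' then 1 else 0) (a : ι → ℕ) (i : ι) :
    hermiteProd u (a + Pi.single i 1) =
      linearForm (u i) * hermiteProd u a - dirDeriv (u i) (hermiteProd u a) := by
  have hd : dirDeriv (u i) (hermiteProd u a) = (a i : ℝ) • hermiteProd u (a - Pi.single i 1) := by
    rw [dirDeriv_hermiteProd]
    simp [hu]
  rw [hd, hermiteProd_eq_mul_prod_erase u i (a := a) (a' := a) fun _ _ => rfl,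
    hermiteProd_eq_mul_prod_erase u i (a := a) (a' := a + Pi.single i 1) fun _ h => by simp [h],
    hermiteProd_eq_mul_prod_erase u i (a := a) (a' := a - Pi.single i 1) fun _ h => by simp [h]]
  simp only [Pi.add_apply, Pi.sub_apply, Pi.single_eq_same, Polynomial.hermite_succ,
    derivative_hermite, map_sub, map_mul, Polynomial.aeval_X, map_natCast,
    MvPolynomial.smul_eq_C_mul]
  ring

theorem gaussianExpectation_hermiteProd_add_single {u : ι → σ → ℝ}
    (hu : ∀ i i', ∑ k, u i k * u i' k = if i = i' then 1 else 0) (v : κ → σ → ℝ)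
    (a : ι → ℕ) (b : κ → ℕ) (i : ι) :
    gaussianExpectation σ (hermiteProd u (a + Pi.single i 1) * hermiteProd v b) =
      ∑ j, (∑ k, u i k * v j k) * (b j *
        gaussianExpectation σ (hermiteProd u a * hermiteProd v (b - Pi.single j 1))) := by
  rw [hermiteProd_add_single hu, sub_mul, mul_assoc, map_sub, gaussianExpectation_linearForm_mul,
    Derivation.leibniz, map_add, smul_eq_mul, smul_eq_mul, mul_comm (hermiteProd v b),
    add_sub_cancel_right, dirDeriv_hermiteProd, mul_sum, map_sum]
  simp [mul_assoc]

theorem gaussianExpectation_hermiteProd_mul_hermiteProd {u : ι → σ → ℝ} {v : κ → σ → ℝ}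
    (hu : ∀ i i', ∑ k, u i k * u i' k = if i = i' then 1 else 0)
    (hv : ∀ j j', ∑ k, v j k * v j' k = if j = j' then 1 else 0)
    (a : ι → ℕ) (b : κ → ℕ) :
    gaussianExpectation σ (hermiteProd u a * hermiteProd v b) =
      ((∏ i, Nat.factorial (a i) : ℕ) : ℝ) * (∏ j, Nat.factorial (b j) : ℕ) *
        contingencySum (fun i j => ∑ k, u i k * v j k) a b := by
  induction hn : ∑ i, a i generalizing a b with
  | zero =>
    obtain rfl : a = 0 := by
      ext i
      exact (sum_eq_zero_iff.1 hn) i (mem_univ i)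
    by_cases hb : b = 0
    · subst hb
      simp [hermiteProd, gaussianExpectation_one, contingencySum_zero_zero]
    · obtain ⟨j, hj⟩ := Function.ne_iff.1 hb
      rw [contingencySum_eq_zero_of_sum_ne, mul_zero, mul_comm, ← sub_single_add_single hj,
        gaussianExpectation_hermiteProd_add_single hv]
      · simp
      · rw [hn]
        exact (sum_pos' (fun _ _ => zero_le) ⟨j, mem_univ j, Nat.pos_of_ne_zero hj⟩).ne
  | succ n ih =>
    obtain ⟨i, -, hi⟩ := exists_ne_zero_of_sum_ne_zero (hn.trans_ne n.succ_ne_zero)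
    rw [← sub_single_add_single hi] at hn ⊢
    rw [gaussianExpectation_hermiteProd_add_single hu, factorial_mul_contingencySum_add_single]
    refine sum_congr rfl fun j _ => ?_
    rw [ih]
    simpa [sum_add_distrib] using hn

end GaussianExpectation

theorem eval_hermiteProd {σ ι : Type*} [Fintype σ] [Fintype ι] (u : ι → σ → ℝ) (a : ι → ℕ)
    (x : σ → ℝ) :
    MvPolynomial.eval x (hermiteProd u a) =
      ∏ i, Polynomial.aeval (∑ k, u i k * x k) (Polynomial.hermite (a i)) := by
  rw [hermiteProd, map_prod]
  refine prod_congr rfl fun i _ => ?_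
  have h := Polynomial.aeval_algHom_apply (MvPolynomial.eval x).toIntAlgHom (linearForm (u i))
    (Polynomial.hermite (a i))
  simpa [linearForm, MvPolynomial.smul_eval] using h.symm

theorem prod_normalizedHermite {σ ι : Type*} [Fintype σ] [Fintype ι] (u : ι → σ → ℝ) (a : ι → ℕ)
    (x : σ → ℝ) :
    ∏ i, normalizedHermite (a i) (∑ k, u i k * x k) =
      (Real.sqrt (∏ i, Nat.factorial (a i) : ℕ))⁻¹ * MvPolynomial.eval x (hermiteProd u a) := by
  simp only [normalizedHermite]
  rw [eval_hermiteProd, prod_div_distrib, Nat.cast_prod, Real.sqrt_prod _ fun _ _ => by positivity,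
    div_eq_inv_mul]

/-- For orthonormal families `(u_i)_{i=1}^ℓ`, `(v_j)_{j=1}^{ℓ'}` in `ℝ^L`
and the standard Gaussian product measure `γ_L`,
`∫ (Π_i Ĥ_{a_i}(⟨u_i,x⟩)) (Π_j Ĥ_{a'_j}(⟨v_j,x⟩)) dγ_L
  = √(a!·a'!) Σ_{(k_{ij})} Π_i Π_j ⟨u_i,v_j⟩^{k_{ij}} / k_{ij}!`,
the sum being over matrices of nonnegative integers with row sums `a` and column sums `a'`;
in particular the integral vanishes when `|a| ≠ |a'|`. -/
theorem gaussian_integral_hermite_products (L ℓ ℓ' : ℕ)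
    (hL : 0 < L) (hℓ : 0 < ℓ) (hℓ' : 0 < ℓ')
    (u : Fin ℓ → Fin L → ℝ) (v : Fin ℓ' → Fin L → ℝ)
    (hu : ∀ i i' : Fin ℓ, ∑ k, u i k * u i' k = if i = i' then 1 else 0)
    (hv : ∀ j j' : Fin ℓ', ∑ k, v j k * v j' k = if j = j' then 1 else 0) :
    (∀ (a : Fin ℓ → ℕ) (a' : Fin ℓ' → ℕ),
      ∫ x : Fin L → ℝ,
          (∏ i, normalizedHermite (a i) (∑ k, u i k * x k)) *
            (∏ j, normalizedHermite (a' j) (∑ k, v j k * x k))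
          ∂(Measure.pi fun _ : Fin L => gaussianReal 0 1)
        = Real.sqrt ((∏ i, Nat.factorial (a i)) * (∏ j, Nat.factorial (a' j))) *
            ∑' K : {K : Fin ℓ → Fin ℓ' → ℕ //
                (∀ i, ∑ j, K i j = a i) ∧ (∀ j, ∑ i, (K : Fin ℓ → Fin ℓ' → ℕ) i j = a' j)},
              ∏ i, ∏ j,
                (∑ k, u i k * v j k) ^ ((K : Fin ℓ → Fin ℓ' → ℕ) i j) /
                  Nat.factorial ((K : Fin ℓ → Fin ℓ' → ℕ) i j)) ∧
    (∀ (a : Fin ℓ → ℕ) (a' : Fin ℓ' → ℕ), (∑ i, a i) ≠ (∑ j, a' j) →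
      ∫ x : Fin L → ℝ,
          (∏ i, normalizedHermite (a i) (∑ k, u i k * x k)) *
            (∏ j, normalizedHermite (a' j) (∑ k, v j k * x k))
          ∂(Measure.pi fun _ : Fin L => gaussianReal 0 1)
        = 0) := by
  have key (a : Fin ℓ → ℕ) (a' : Fin ℓ' → ℕ) : ∫ x : Fin L → ℝ,
      (∏ i, normalizedHermite (a i) (∑ k, u i k * x k)) *
        (∏ j, normalizedHermite (a' j) (∑ k, v j k * x k))
        ∂(Measure.pi fun _ : Fin L => gaussianReal 0 1) =
      Real.sqrt ((∏ i, Nat.factorial (a i)) * (∏ j, Nat.factorial (a' j))) *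
        contingencySum (fun i j => ∑ k, u i k * v j k) a a' := by
    have h := gaussianExpectation_hermiteProd_mul_hermiteProd hu hv a a'
    simp only [gaussianExpectation, LinearMap.coe_mk, AddHom.coe_mk, map_mul] at h
    simp_rw [prod_normalizedHermite, mul_mul_mul_comm _ (MvPolynomial.eval _ _)]
    rw [integral_const_mul, h, Real.sqrt_mul (Nat.cast_nonneg _)]
    have hpos (n : ℕ) (f : Fin n → ℕ) : (0 : ℝ) < (∏ i, Nat.factorial (f i) : ℕ) := by positivity
    have hs (n : ℕ) (f : Fin n → ℕ) := Real.mul_self_sqrt (hpos n f).le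
    have hs0 (n : ℕ) (f : Fin n → ℕ) := (Real.sqrt_pos.2 (hpos n f)).ne'
    nth_rw 2 [← hs ℓ a, ← hs ℓ' a']
    field_simp [hs0 ℓ a, hs0 ℓ' a']
  refine ⟨key, fun a a' h => ?_⟩
  rw [key, contingencySum_eq_zero_of_sum_ne _ h, mul_zero]
end

section
/- Let ℓ, ℓ', m be positive integers, let a ∈ ℤ₊^ℓ and a' ∈ ℤ₊^{ℓ'} be multi-indices with |a| = |a'| = m, and let c : {1,…,ℓ} × {1,…,ℓ'} → ℝ. Then Σ_f Σ_g Π_{n=1}^{m} c(f(n), g(n)) = m! · Σ_{(k_{ij})} Π_{i=1}^{ℓ} Π_{j=1}^{ℓ'} c(i,j)^{k_{ij}} / k_{ij}!, where the outer sums are over all functions f : {1,…,m} → {1,…,ℓ} with #f⁻¹({i}) = a_i for every i and all functions g : {1,…,m} → {1,…,ℓ'} with #g⁻¹({j}) = a'_j for every j, and the right-hand sum is over all matrices (k_{ij}) ∈ ℤ₊^{ℓ×ℓ'} satisfying Σ_{j=1}^{ℓ'} k_{ij} = a_i for every i and Σ_{i=1}^{ℓ} k_{ij} = a'_j for every j.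 -/
open Finset

/-- The number of words of length `m` in which each letter `i` occurs `k i` times. -/
theorem card_functions_with_fiber_cards_eq_multinomial {α : Type*} [Fintype α] [DecidableEq α]
    (m : ℕ) (k : α → ℕ) (hk : ∑ i, k i = m) :
    #{f : Fin m → α | ∀ i, #{n | f n = i} = k i} = Nat.multinomial univ k := by
  have expand : (∑ i : α, (MvPolynomial.X i : MvPolynomial α ℕ)) ^ m =
      ∑ f : Fin m → α, MvPolynomial.monomial (∑ n, Finsupp.single (f n) 1) 1 := by
    rw [← Fin.prod_const, Fintype.prod_sum]
    refine sum_congr rfl fun f _ => ?_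
    rw [MvPolynomial.monomial_sum_one]
    rfl
  have collect := Finset.sum_pow_eq_sum_piAntidiag (univ : Finset α)
    (fun i => (MvPolynomial.X i : MvPolynomial α ℕ)) m
  have hmon : ∀ l : α → ℕ, ∏ i, (MvPolynomial.X i : MvPolynomial α ℕ) ^ l i =
      MvPolynomial.monomial (Finsupp.equivFunOnFinite.symm l) 1 := by
    intro l
    rw [MvPolynomial.monomial_eq, Finsupp.prod_fintype _ _ (by simp)]
    simp
  rw [expand] at collect
  have key := congrArg (MvPolynomial.coeff (Finsupp.equivFunOnFinite.symm k)) collect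
  simp only [hmon, ← map_natCast (MvPolynomial.C : ℕ →+* MvPolynomial α ℕ),
    MvPolynomial.coeff_sum, MvPolynomial.coeff_C_mul, MvPolynomial.coeff_monomial,
    EmbeddingLike.apply_eq_iff_eq, mul_ite, mul_one, mul_zero] at key
  rw [sum_ite_eq_of_mem' _ _ _ (by simp [hk])] at key
  rw [card_filter]
  refine Eq.trans (sum_congr rfl fun f _ => ?_) key
  refine if_congr ?_ rfl rfl
  rw [DFunLike.ext_iff]
  refine forall_congr' fun i => ?_
  simp [Finsupp.finsetSum_apply, Finsupp.single_apply, eq_comm]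

/-- Counting occurrences of pairs and summing over the second letter counts the first letter. -/
theorem sum_card_pair_fiber {ι α β : Type*} [Fintype ι] [DecidableEq α] [Fintype β]
    [DecidableEq β] (f : ι → α) (g : ι → β) (i : α) :
    ∑ j, #{n | f n = i ∧ g n = j} = #{n | f n = i} := by
  rw [card_eq_sum_card_fiberwise (f := g) (t := univ) (by simp [Set.MapsTo])]
  simp only [filter_filter]

/-- A product over positions is a product over pairs of letters, with multiplicities. -/
theorem prod_comp_pair_eq_prod_pow {ι α β M : Type*} [Fintype ι] [Fintype α] [DecidableEq α]
    [Fintype β] [DecidableEq β] [CommMonoid M] (c : α → β → M) (f : ι → α) (g : ι → β) :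
    ∏ n, c (f n) (g n) = ∏ i, ∏ j, c i j ^ #{n | f n = i ∧ g n = j} := by
  rw [← Fintype.prod_prod_type', ← prod_fiberwise univ (fun n => (f n, g n))]
  refine prod_congr rfl fun p _ => ?_
  rw [← prod_const]
  simp only [Prod.ext_iff]
  refine prod_congr rfl fun n hn => ?_
  obtain ⟨h₁, h₂⟩ := (mem_filter.1 hn).2
  rw [h₁, h₂]

/-- The reparameterization identity: for multi-indices `a, a'` with
`|a| = |a'| = m` and any `c : {1,…,ℓ} × {1,…,ℓ'} → ℝ`,
`Σ_f Σ_g Π_n c(f(n), g(n)) = m! · Σ_{(k_{ij})} Π_i Π_j c(i,j)^{k_{ij}} / k_{ij}!`,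
where `f` ranges over functions with fiber cardinalities `a`, `g` over functions with fiber
cardinalities `a'`, and `(k_{ij})` over matrices of nonnegative integers with row sums `a`
and column sums `a'`. -/
theorem sum_over_fiber_functions_eq_sum_over_matrices (ℓ ℓ' m : ℕ)
    (hℓ : 0 < ℓ) (hℓ' : 0 < ℓ') (hm : 0 < m)
    (a : Fin ℓ → ℕ) (a' : Fin ℓ' → ℕ) (ha : ∑ i, a i = m) (ha' : ∑ j, a' j = m)
    (c : Fin ℓ → Fin ℓ' → ℝ) :
    ∑ f ∈ Finset.univ.filter (fun f : Fin m → Fin ℓ =>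
        ∀ i, (Finset.univ.filter (fun n : Fin m => f n = i)).card = a i),
      ∑ g ∈ Finset.univ.filter (fun g : Fin m → Fin ℓ' =>
        ∀ j, (Finset.univ.filter (fun n : Fin m => g n = j)).card = a' j),
        ∏ n : Fin m, c (f n) (g n)
      = (Nat.factorial m : ℝ) *
        ∑' k : {k : Fin ℓ → Fin ℓ' → ℕ //
            (∀ i, ∑ j, k i j = a i) ∧ (∀ j, ∑ i, (k : Fin ℓ → Fin ℓ' → ℕ) i j = a' j)},
          ∏ i, ∏ j, c i j ^ (k : Fin ℓ → Fin ℓ' → ℕ) i j /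
            Nat.factorial ((k : Fin ℓ → Fin ℓ' → ℕ) i j) := by
  classical
  set K : Finset (Fin ℓ → Fin ℓ' → ℕ) := (Finset.Iic fun _ _ => m).filter fun k =>
    (∀ i, ∑ j, k i j = a i) ∧ ∀ j, ∑ i, k i j = a' j with hK
  have mem_K : ∀ k, k ∈ K ↔ (∀ i, ∑ j, k i j = a i) ∧ ∀ j, ∑ i, k i j = a' j := by
    intro k
    rw [hK, mem_filter, mem_Iic, and_iff_right_iff_imp]
    rintro ⟨h, -⟩ i j
    calc k i j ≤ ∑ j, k i j := single_le_sum (fun _ _ => Nat.zero_le _) (mem_univ j)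
      _ = a i := h i
      _ ≤ ∑ i, a i := single_le_sum (fun _ _ => Nat.zero_le _) (mem_univ i)
      _ = m := ha
  have tsum_K : ∀ F : (Fin ℓ → Fin ℓ' → ℕ) → ℝ,
      ∑' k : {k : Fin ℓ → Fin ℓ' → ℕ //
        (∀ i, ∑ j, k i j = a i) ∧ (∀ j, ∑ i, k i j = a' j)}, F k = ∑ k ∈ K, F k := by
    intro F
    rw [← Finset.tsum_subtype K F]
    exact ((Equiv.subtypeEquivRight mem_K).tsum_eq fun k => F k.1).symm
  rw [tsum_K fun k => ∏ i, ∏ j, c i j ^ k i j / Nat.factorial (k i j), ← sum_product', mul_sum]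
  have maps : ∀ (f : Fin m → Fin ℓ) (g : Fin m → Fin ℓ') (k : Fin ℓ → Fin ℓ' → ℕ),
      (fun i j => #{n | f n = i ∧ g n = j}) = k →
      (((∀ i, #{n | f n = i} = a i) ∧ ∀ j, #{n | g n = j} = a' j) ↔ k ∈ K) := by
    rintro f g _ rfl
    rw [mem_K]
    have col : ∀ j, ∑ i, #{n | f n = i ∧ g n = j} = #{n | g n = j} := fun j => by
      simpa only [and_comm] using sum_card_pair_fiber g f j
    simp only [sum_card_pair_fiber, col]
  rw [← sum_fiberwise_of_maps_to (t := K)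
    (g := fun p i j => #{n | p.1 n = i ∧ p.2 n = j}) (by
      rintro ⟨f, g⟩ hp
      simp only [mem_product, mem_filter, mem_univ, true_and] at hp
      exact (maps f g _ rfl).1 hp)]
  refine sum_congr rfl fun k hk => ?_
  have total : ∑ p : Fin ℓ × Fin ℓ', k p.1 p.2 = m := by
    rw [Fintype.sum_prod_type, ← ha]
    exact sum_congr rfl fun i _ => ((mem_K k).1 hk).1 i
  rw [sum_congr rfl (g := fun _ => ∏ i, ∏ j, c i j ^ k i j) (by
    rintro ⟨f, g⟩ hp
    rw [prod_comp_pair_eq_prod_pow, ← (mem_filter.1 hp).2]), sum_const, nsmul_eq_mul]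
  have count := card_functions_with_fiber_cards_eq_multinomial m
    (fun p : Fin ℓ × Fin ℓ' => k p.1 p.2) total
  rw [card_equiv (Equiv.arrowProdEquivProdArrow (Fin m) (fun _ => Fin ℓ) (fun _ => Fin ℓ')).symm
    (t := {h | ∀ p : Fin ℓ × Fin ℓ', #{n | h n = p} = k p.1 p.2}) (by
      rintro ⟨f, g⟩
      have := maps f g k
      simp only [mem_filter, mem_product, mem_univ, true_and]
      rw [and_iff_right_of_imp fun h => (this h).2 hk]
      simp [funext_iff, Equiv.arrowProdEquivProdArrow, Prod.ext_iff]), count]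
  have spec := Nat.multinomial_spec univ fun p : Fin ℓ × Fin ℓ' => k p.1 p.2
  rw [total, Fintype.prod_prod_type] at spec
  rw [← spec]
  simp only [prod_div_distrib]
  push_cast
  have : (∏ i, ∏ j, ((k i j).factorial : ℝ)) ≠ 0 := by
    simp only [prod_ne_zero_iff]
    intro i _ j _
    exact_mod_cast Nat.factorial_ne_zero _
  field_simp
end

section
/- Let N₀, N₁, n be positive integers and let a ∈ ℤ₊^{N₀} be a multi-index. Then Σ_{a'} (a! / a'!) · N₁^{-|a|} ≤ |a|^n / (n! · N₁^n), where the sum is over all multi-indices a' ∈ ℤ₊^{N₀N₁} that match a and for which there exists ℓ' ∈ ℕ with a'_{ℓ'} > n and a'_i = 0 for all i > ℓ'. -/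
open Finset

/-- The last nonzero entry of `a'` exceeds `n`: there is `ℓ'` with `a'_{ℓ'} > n` and
`a'_i = 0` for all `i > ℓ'`. -/
def LastEntryExceeds (M n : ℕ) (a' : Fin M → ℕ) : Prop :=
  ∃ ℓ' : Fin M, a' ℓ' > n ∧ ∀ i : Fin M, ℓ' < i → a' i = 0

/-- The entries of a matching multi-index sum to `a i` over the `i`-th block. -/
lemma MultiIndexMatches.sum_block {N₀ N₁ : ℕ} {a : Fin N₀ → ℕ} {c : Fin (N₀ * N₁) → ℕ}
    (h : MultiIndexMatches N₀ N₁ a c) (i : Fin N₀) :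
    ∑ j, c (finProdFinEquiv (i, j)) = a i := by
  have key : ∀ i : Fin N₀,
      ∑ k ∈ Finset.univ.filter (fun k : Fin N₀ => k ≤ i), ∑ j, c (finProdFinEquiv (k, j))
        = ∑ k ∈ Finset.univ.filter (fun k : Fin N₀ => k ≤ i), a k := by
    intro i
    rw [← h i, Finset.sum_filter, Finset.sum_filter, ← finProdFinEquiv.sum_comp,
      Fintype.sum_prod_type]
    refine Finset.sum_congr rfl fun k _ => ?_
    have hiff : ∀ j : Fin N₁,
        ((finProdFinEquiv (k, j) : Fin (N₀ * N₁)) : ℕ) < ((i : ℕ) + 1) * N₁ ↔ k ≤ i := by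
      intro j
      have hj := j.isLt
      simp only [finProdFinEquiv_apply_val, Fin.le_def]
      constructor
      · intro hlt
        by_contra! hki
        have := Nat.mul_le_mul_right N₁ (Nat.succ_le_of_lt hki)
        rw [Nat.succ_eq_add_one] at this
        nlinarith
      · intro hki
        have := Nat.mul_le_mul_right N₁ hki
        nlinarith
    simp only [hiff]
    split_ifs <;> simp
  induction i using WellFoundedLT.induction with
  | ind i ih =>
    have hi := key i
    have hins : Finset.univ.filter (fun k : Fin N₀ => k ≤ i)
        = insert i (Finset.univ.filter (fun k : Fin N₀ => k < i)) := by
      ext k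
      simp [le_iff_eq_or_lt]
    rw [hins, Finset.sum_insert (by simp), Finset.sum_insert (by simp),
      Finset.sum_congr rfl (fun k hk => ih k (Finset.mem_filter.1 hk).2)] at hi
    exact Nat.add_right_cancel hi

/-- The multinomial theorem with all variables equal to one. -/
lemma sum_piAntidiag_inv_factorial (N m : ℕ) :
    ∑ b ∈ Finset.piAntidiag (Finset.univ : Finset (Fin N)) m,
      (∏ j, ((Nat.factorial (b j) : ℕ) : ℝ))⁻¹ = (N : ℝ) ^ m / (Nat.factorial m : ℝ) := by
  have h := Finset.sum_pow_eq_sum_piAntidiag (Finset.univ : Finset (Fin N)) (fun _ => (1 : ℝ)) m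
  simp only [Finset.sum_const, Finset.card_univ, Fintype.card_fin, nsmul_eq_mul, mul_one, one_pow,
    Finset.prod_const_one] at h
  rw [h, Finset.sum_div]
  refine Finset.sum_congr rfl fun b hb => ?_
  have hsum : ∑ j, b j = m := (Finset.mem_piAntidiag.1 hb).1
  have hspec := Nat.multinomial_spec (Finset.univ : Finset (Fin N)) b
  rw [hsum] at hspec
  have hspec' : (∏ j, ((Nat.factorial (b j) : ℕ) : ℝ)) * (Nat.multinomial Finset.univ b : ℝ)
      = (Nat.factorial m : ℝ) := by exact_mod_cast hspec
  have hpos : (∏ j, ((Nat.factorial (b j) : ℕ) : ℝ)) ≠ 0 :=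
    Finset.prod_ne_zero_iff.2 fun j _ => by positivity
  have hm : (Nat.factorial m : ℝ) ≠ 0 := by positivity
  field_simp
  rw [← hspec', mul_comm]

/-- The multinomial theorem applied blockwise. -/
lemma sum_piFinset_inv_factorial (N₀ N₁ : ℕ) (a : Fin N₀ → ℕ) :
    ∑ g ∈ Fintype.piFinset
        (fun i => Finset.piAntidiag (Finset.univ : Finset (Fin N₁)) (a i)),
      (∏ i, ∏ j, ((Nat.factorial (g i j) : ℕ) : ℝ))⁻¹
      = (N₁ : ℝ) ^ (∑ i, a i) / ∏ i, ((Nat.factorial (a i) : ℕ) : ℝ) := by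
  simp_rw [← Finset.prod_inv_distrib]
  rw [← Finset.prod_univ_sum
    (fun i => Finset.piAntidiag (Finset.univ : Finset (Fin N₁)) (a i))
    (fun _ b => ∏ j, ((Nat.factorial (b j) : ℕ) : ℝ)⁻¹)]
  simp_rw [Finset.prod_inv_distrib, sum_piAntidiag_inv_factorial]
  rw [Finset.prod_div_distrib, Finset.prod_pow_eq_pow_sum]

/-- The sum of inverse factorials over any family of multi-indices with prescribed block sums,
injectively parametrised, is at most the full multinomial sum. -/
lemma sum_inv_factorial_le {ι : Type*} (N₀ N₁ : ℕ) (a : Fin N₀ → ℕ) (s : Finset ι)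
    (q : ι → Fin (N₀ * N₁) → ℕ) (hq : Set.InjOn q s)
    (hsum : ∀ x ∈ s, ∀ i, ∑ j, q x (finProdFinEquiv (i, j)) = a i) :
    ∑ x ∈ s, (∏ k, ((Nat.factorial (q x k) : ℕ) : ℝ))⁻¹
      ≤ (N₁ : ℝ) ^ (∑ i, a i) / ∏ i, ((Nat.factorial (a i) : ℕ) : ℝ) := by
  classical
  rw [← sum_piFinset_inv_factorial]
  set φ : ι → Fin N₀ → Fin N₁ → ℕ := fun x i j => q x (finProdFinEquiv (i, j)) with hφ
  have hinj : Set.InjOn φ s := by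
    intro x hx y hy hxy
    refine hq hx hy (funext fun k => ?_)
    obtain ⟨⟨i, j⟩, rfl⟩ := finProdFinEquiv.surjective k
    exact congrFun (congrFun hxy i) j
  calc ∑ x ∈ s, (∏ k, ((Nat.factorial (q x k) : ℕ) : ℝ))⁻¹
      = ∑ x ∈ s, (∏ i, ∏ j, ((Nat.factorial (φ x i j) : ℕ) : ℝ))⁻¹ := by
        refine Finset.sum_congr rfl fun x _ => ?_
        rw [← finProdFinEquiv.prod_comp, Fintype.prod_prod_type]
    _ = ∑ g ∈ s.image φ, (∏ i, ∏ j, ((Nat.factorial (g i j) : ℕ) : ℝ))⁻¹ :=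
        (Finset.sum_image (f := fun g : Fin N₀ → Fin N₁ → ℕ =>
          (∏ i, ∏ j, ((Nat.factorial (g i j) : ℕ) : ℝ))⁻¹) hinj).symm
    _ ≤ _ := by
        refine Finset.sum_le_sum_of_subset_of_nonneg ?_ fun g _ _ => by positivity
        intro g hg
        obtain ⟨x, hx, rfl⟩ := Finset.mem_image.1 hg
        simp only [Fintype.mem_piFinset, Finset.mem_piAntidiag]
        exact fun i => ⟨hsum x hx i, by simp⟩

/-- A multi-index with an entry exceeding `n`, lowered by `n` there. -/
lemma factorial_mul_prod_factorial_sub_le {ι : Type*} [Fintype ι] [DecidableEq ι] (c : ι → ℕ)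
    (l : ι) (n : ℕ) (h : n ≤ c l) :
    Nat.factorial n * ∏ k, Nat.factorial ((c - Pi.single l n : ι → ℕ) k) ≤ ∏ k, Nat.factorial (c k) := by
  have hn : Nat.factorial n = ∏ k : ι, if k = l then Nat.factorial n else 1 := by simp
  rw [hn, ← Finset.prod_mul_distrib]
  refine Finset.prod_le_prod' fun k _ => ?_
  by_cases hk : k = l
  · subst hk
    simp only [if_true, Pi.sub_apply, Pi.single_eq_same]
    exact Nat.le_of_dvd (Nat.factorial_pos _) (Nat.factorial_mul_factorial_dvd_factorial h)
  · simp [hk]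

lemma prod_factorial_le_pow_mul {ι : Type*} [Fintype ι] [DecidableEq ι] (a : ι → ℕ)
    (l : ι) (n : ℕ) (h : n ≤ a l) :
    ∏ k, Nat.factorial (a k) ≤ (a l) ^ n * ∏ k, Nat.factorial ((a - Pi.single l n : ι → ℕ) k) := by
  have hn : (a l) ^ n = ∏ k : ι, if k = l then (a l) ^ n else 1 := by simp
  rw [hn, ← Finset.prod_mul_distrib]
  refine Finset.prod_le_prod' fun k _ => ?_
  by_cases hk : k = l
  · subst hk
    simp only [if_true, Pi.sub_apply, Pi.single_eq_same]
    rw [← Nat.factorial_mul_descFactorial h, mul_comm]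
    exact Nat.mul_le_mul_right _ (Nat.descFactorial_le_pow _ _)
  · simp [hk]

lemma eq_of_sub_single_eq {ι : Type*} [LinearOrder ι] {c d : ι → ℕ} {l m : ι} {n : ℕ}
    (hc : n < c l) (hc' : ∀ i, l < i → c i = 0) (hd : n < d m) (hd' : ∀ i, m < i → d i = 0)
    (h : c - Pi.single l n = d - Pi.single m n) : c = d := by
  have hlm : l = m := by
    rcases lt_trichotomy l m with hlt | heq | hgt
    · have := congrFun h m
      simp [hc' m hlt] at this
      omega
    · exact heq
    · have := congrFun h l
      simp [hd' l hgt] at this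
      omega
  subst hlm
  funext k
  have := congrFun h k
  by_cases hk : k = l
  · subst hk
    simp at this
    omega
  · simpa [hk] using this

lemma sum_block_sub_single {N₀ N₁ n : ℕ} {a : Fin N₀ → ℕ} {c : Fin (N₀ * N₁) → ℕ}
    (h : ∀ i, ∑ j, c (finProdFinEquiv (i, j)) = a i) (i₀ : Fin N₀) (j₀ : Fin N₁)
    (hn : n ≤ c (finProdFinEquiv (i₀, j₀))) (i : Fin N₀) :
    ∑ j, (c - Pi.single (finProdFinEquiv (i₀, j₀)) n : Fin (N₀ * N₁) → ℕ) (finProdFinEquiv (i, j))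
      = (a - Pi.single i₀ n : Fin N₀ → ℕ) i := by
  have hle : ∀ j ∈ Finset.univ,
      (Pi.single (finProdFinEquiv (i₀, j₀)) n : Fin (N₀ * N₁) → ℕ) (finProdFinEquiv (i, j))
        ≤ c (finProdFinEquiv (i, j)) := by
    intro j _
    rw [Pi.single_apply]
    split_ifs with hij
    · rwa [hij]
    · exact Nat.zero_le _
  simp only [Pi.sub_apply]
  rw [Finset.sum_tsub_distrib _ hle, h]
  congr 1
  simp only [Pi.single_apply, finProdFinEquiv.apply_eq_iff_eq, Prod.mk.injEq]
  by_cases hi : i = i₀ <;> simp [hi]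

/-- The block containing the last nonzero entry is the last nonzero entry of `a`. -/
lemma last_block_spec {N₀ N₁ n : ℕ} {a : Fin N₀ → ℕ} {c : Fin (N₀ * N₁) → ℕ}
    (h : ∀ i, ∑ j, c (finProdFinEquiv (i, j)) = a i) {i₀ : Fin N₀} {j₀ : Fin N₁}
    (hn : n < c (finProdFinEquiv (i₀, j₀)))
    (hz : ∀ k, finProdFinEquiv (i₀, j₀) < k → c k = 0) :
    n < a i₀ ∧ ∀ i, i₀ < i → a i = 0 := by
  refine ⟨?_, fun i hi => ?_⟩
  · rw [← h]
    exact hn.trans_le (Finset.single_le_sum (f := fun j => c (finProdFinEquiv (i₀, j)))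
      (fun _ _ => Nat.zero_le _) (Finset.mem_univ j₀))
  · rw [← h]
    refine Finset.sum_eq_zero fun j _ => hz _ ?_
    have := Nat.mul_le_mul_left N₁ (Nat.succ_le_of_lt (Fin.lt_def.1 hi))
    have hj := j₀.isLt
    simp only [Fin.lt_def, finProdFinEquiv_apply_val]
    rw [Nat.succ_eq_add_one] at this
    nlinarith

/-- `Σ (a!/a'!) · N₁^{-|a|} ≤ |a|^n / (n! N₁^n)`, the sum being over all
`a'` matching `a` whose last nonzero entry exceeds `n` (Lemma 4.6(2)). -/
theorem sum_matching_tail_le (N₀ N₁ n : ℕ) (hN₀ : 0 < N₀) (hN₁ : 0 < N₁) (hn : 0 < n)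
    (a : Fin N₀ → ℕ) :
    ∑' a' : {a' : Fin (N₀ * N₁) → ℕ //
        MultiIndexMatches N₀ N₁ a a' ∧ LastEntryExceeds (N₀ * N₁) n a'},
      ((∏ i, Nat.factorial (a i) : ℕ) : ℝ) /
          ((∏ j, Nat.factorial ((a' : Fin (N₀ * N₁) → ℕ) j) : ℕ) : ℝ) *
        ((N₁ : ℝ) ^ (∑ i, a i))⁻¹
      ≤ ((∑ i, a i : ℕ) : ℝ) ^ n / (Nat.factorial n * (N₁ : ℝ) ^ n) := by
  rcases isEmpty_or_nonempty {a' : Fin (N₀ * N₁) → ℕ //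
      MultiIndexMatches N₀ N₁ a a' ∧ LastEntryExceeds (N₀ * N₁) n a'} with hE | ⟨⟨c₀, hc₀, hl₀⟩⟩
  · rw [tsum_empty]
    positivity
  have hspec : ∀ x : {a' : Fin (N₀ * N₁) → ℕ //
      MultiIndexMatches N₀ N₁ a a' ∧ LastEntryExceeds (N₀ * N₁) n a'}, ∃ p : Fin N₀ × Fin N₁,
      n < x.1 (finProdFinEquiv p) ∧ ∀ k, finProdFinEquiv p < k → x.1 k = 0 := by
    rintro ⟨c, -, l, hl⟩
    obtain ⟨p, rfl⟩ := finProdFinEquiv.surjective l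
    exact ⟨p, hl⟩
  choose p hp hpz using hspec
  obtain ⟨i₀, hi₀⟩ : ∃ i₀, i₀ = (p ⟨c₀, hc₀, hl₀⟩).1 := ⟨_, rfl⟩
  have hblock := fun x => last_block_spec (MultiIndexMatches.sum_block x.2.1) (hp x) (hpz x)
  have ha : n < a i₀ := hi₀ ▸ (hblock ⟨c₀, hc₀, hl₀⟩).1
  have haz : ∀ i, i₀ < i → a i = 0 := hi₀ ▸ (hblock ⟨c₀, hc₀, hl₀⟩).2
  have hp₁ : ∀ x, (p x).1 = i₀ := by
    intro x
    obtain ⟨h₁, h₂⟩ := hblock x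
    rcases lt_trichotomy (p x).1 i₀ with hlt | heq | hgt
    · have := h₂ _ hlt
      omega
    · exact heq
    · have := haz _ hgt
      omega
  set b : Fin N₀ → ℕ := a - Pi.single i₀ n with hb
  have hab : ∑ i, a i = ∑ i, b i + n := by
    have hle : Pi.single i₀ n ≤ a := by
      intro i
      by_cases hi : i = i₀
      · subst hi
        simpa using ha.le
      · simp [hi]
    have : a = b + Pi.single i₀ n := (tsub_add_cancel_of_le hle).symm
    conv_lhs => rw [this]
    simp [Finset.sum_add_distrib]
  have hfac : ((∏ i, Nat.factorial (a i) : ℕ) : ℝ)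
      ≤ ((∑ i, a i : ℕ) : ℝ) ^ n * ∏ i, ((Nat.factorial (b i) : ℕ) : ℝ) := by
    have h₁ := prod_factorial_le_pow_mul a i₀ n ha.le
    have h₂ : a i₀ ≤ ∑ i, a i :=
      Finset.single_le_sum (fun _ _ => Nat.zero_le _) (Finset.mem_univ i₀)
    exact_mod_cast h₁.trans (Nat.mul_le_mul_right _ (Nat.pow_le_pow_left h₂ n))
  have hNpos : (0 : ℝ) < N₁ := by exact_mod_cast hN₁
  have hbpos : 0 < ∏ i, ((Nat.factorial (b i) : ℕ) : ℝ) :=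
    Finset.prod_pos fun i _ => by positivity
  refine Real.tsum_le_of_sum_le (fun x => by positivity) fun s => ?_
  let q : {a' : Fin (N₀ * N₁) → ℕ //
      MultiIndexMatches N₀ N₁ a a' ∧ LastEntryExceeds (N₀ * N₁) n a'} → Fin (N₀ * N₁) → ℕ :=
    fun x => x.1 - Pi.single (finProdFinEquiv (p x)) n
  have hS := sum_inv_factorial_le N₀ N₁ b s q
    (fun x _ y _ hxy => Subtype.ext (eq_of_sub_single_eq (hp x) (hpz x) (hp y) (hpz y) hxy))
    (fun x _ i => by
      rw [hb, ← hp₁ x]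
      exact sum_block_sub_single (MultiIndexMatches.sum_block x.2.1) _ _ (hp x).le i)
  set A : ℝ := ((∏ i, Nat.factorial (a i) : ℕ) : ℝ) with hA
  calc _ ≤ ∑ x ∈ s, A * ((Nat.factorial n : ℝ)⁻¹ * ((N₁ : ℝ) ^ (∑ i, a i))⁻¹)
        * (∏ k, ((Nat.factorial (q x k) : ℕ) : ℝ))⁻¹ := by
        refine Finset.sum_le_sum fun x _ => ?_
        have h₁ : (Nat.factorial n : ℝ) * ∏ k, ((Nat.factorial (q x k) : ℕ) : ℝ)
            ≤ ((∏ j, Nat.factorial (x.1 j) : ℕ) : ℝ) := by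
          exact_mod_cast factorial_mul_prod_factorial_sub_le x.1 _ n (hp x).le
        have h₂ : 0 < ∏ k, ((Nat.factorial (q x k) : ℕ) : ℝ) :=
          Finset.prod_pos fun i _ => by positivity
        calc _ ≤ A / ((Nat.factorial n : ℝ) * ∏ k, ((Nat.factorial (q x k) : ℕ) : ℝ))
              * ((N₁ : ℝ) ^ (∑ i, a i))⁻¹ := by gcongr
          _ = _ := by
            rw [div_eq_mul_inv, mul_inv]
            ring
    _ = A * ((Nat.factorial n : ℝ)⁻¹ * ((N₁ : ℝ) ^ (∑ i, a i))⁻¹)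
        * ∑ x ∈ s, (∏ k, ((Nat.factorial (q x k) : ℕ) : ℝ))⁻¹ := by rw [Finset.mul_sum]
    _ ≤ (((∑ i, a i : ℕ) : ℝ) ^ n * ∏ i, ((Nat.factorial (b i) : ℕ) : ℝ))
        * ((Nat.factorial n : ℝ)⁻¹ * ((N₁ : ℝ) ^ (∑ i, a i))⁻¹)
        * ((N₁ : ℝ) ^ (∑ i, b i) / ∏ i, ((Nat.factorial (b i) : ℕ) : ℝ)) := by gcongr
    _ = _ := by
        have hpow : (N₁ : ℝ) ^ (∑ i, a i) = (N₁ : ℝ) ^ (∑ i, b i) * (N₁ : ℝ) ^ n := by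
          rw [hab, pow_add]
        rw [hpow]
        field_simp
end

section
/- Let A, n be natural numbers with n < A and let t be a real number with t ≥ 1. Then Σ_{k=n+1}^{A} binom(A,k) · (t-1)^{A-k} ≤ binom(A,n) · ( t^{A-n} − (t-1)^{A-n} ), where binom(A,k) = A!/(k!(A-k)!) is the binomial coefficient. -/
open Finset

/-- Choosing `n + j` elements out of `A` can be done by choosing `n` and then `j` more. -/
theorem choose_add_le_choose_mul_choose (A n j : ℕ) :
    A.choose (n + j) ≤ A.choose n * (A - n).choose j := by
  rcases le_or_gt (n + j) A with h | h
  · have key := Nat.choose_mul (n := A) (Nat.le_add_right n j)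
    rw [Nat.add_sub_cancel_left] at key
    rw [← key]
    exact Nat.le_mul_of_pos_right _ (Nat.choose_pos (Nat.le_add_right n j))
  · simp [Nat.choose_eq_zero_of_lt h]

theorem add_one_pow_sub_pow_eq_sum (s : ℝ) (m : ℕ) :
    (1 + s) ^ m - s ^ m = ∑ j ∈ Finset.Icc 1 m, (m.choose j : ℝ) * s ^ (m - j) := by
  rw [add_pow, Finset.range_eq_Ico, Finset.sum_eq_sum_Ico_succ_bot m.succ_pos,
    Nat.succ_eq_add_one, zero_add, Finset.Ico_add_one_right_eq_Icc]
  simp [mul_comm]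

/-- The tail bound for the binomial expansion: for `n < A` and `t ≥ 1`,
`Σ_{k=n+1}^{A} C(A,k) (t-1)^{A-k} ≤ C(A,n) (t^{A-n} − (t-1)^{A-n})`. -/
theorem binomial_tail_le (A n : ℕ) (hn : n < A) (t : ℝ) (ht : 1 ≤ t) :
    ∑ k ∈ Finset.Icc (n + 1) A, (A.choose k : ℝ) * (t - 1) ^ (A - k)
      ≤ (A.choose n : ℝ) * (t ^ (A - n) - (t - 1) ^ (A - n)) := by
  have hs : 0 ≤ t - 1 := sub_nonneg.2 ht
  have hexp := add_one_pow_sub_pow_eq_sum (t - 1) (A - n)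
  rw [add_sub_cancel] at hexp
  have himage : Finset.Icc (n + 1) A = (Finset.Icc 1 (A - n)).image (n + ·) := by
    rw [Finset.image_add_left_Icc, Nat.add_sub_cancel' hn.le]
  rw [hexp, himage, Finset.sum_image (add_right_injective n).injOn, Finset.mul_sum]
  refine Finset.sum_le_sum fun j _ => ?_
  rw [← mul_assoc, ← Nat.sub_sub]
  gcongr
  exact_mod_cast choose_add_le_choose_mul_choose A n j
end
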